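/- For any $2 \le p \le \infty$ and any $t > 0$, the free Schrödinger evolution satisfies $\| e^{it\partial_{xx}} u_0 \|_{L^p(\mathbb{R})} \lesssim (1 + t^{3/2}) \left( \| \partial_{xx} u_0 \|_{L^p(\mathbb{R})} + \| \partial_x u_0 \|_{L^p(\mathbb{R})} + \| u_0 \|_{L^p(\mathbb{R})} \right)$, with an implicit constant independent of $t$, $p$, and $u_0$. -/

import Mathlib

open MeasureTheory Complex Filter
open scoped ENNReal Real Topology

/-- The free Schrödinger propagator on ℝ, `e^{it ∂_xx}`, given by its explicit kernel. -/
noncomputable def sch (t : ℝ) (f : ℝ → ℂ) (x : ℝ) : ℂ :=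
  (((4 * Real.pi * t : ℝ) : ℂ) * Complex.I) ^ (-(1 / 2 : ℂ)) *
    ∫ y : ℝ, Complex.exp (-Complex.I * ((x - y : ℝ) : ℂ) ^ 2 / (4 * (t : ℂ))) * f y

/-- `‖⟨∂ₓ⟩ⁿ f‖_{Lᵖ} = ∑_{j=0}^n ‖∂ₓʲ f‖_{Lᵖ}`. -/
noncomputable def sobNorm (n : ℕ) (p : ℝ≥0∞) (f : ℝ → ℂ) : ℝ≥0∞ :=
  ∑ j ∈ Finset.range (n + 1), eLpNorm (deriv^[j] f) p volume

/-- Mixed spacetime norm `L^p_t L^q_x (I × ℝ)`. -/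
noncomputable def mixNorm (I : Set ℝ) (p q : ℝ≥0∞) (f : ℝ → ℝ → ℂ) : ℝ≥0∞ :=
  eLpNorm (fun t => (eLpNorm (f t) q volume).toReal) p (volume.restrict I)

/-- The real pairing `(f, g) = Re ∫ f ḡ`. -/
noncomputable def pairR (f g : ℝ → ℂ) : ℝ :=
  ∫ x : ℝ, (f x * (starRingEnd ℂ) (g x)).re

/-- Young's inequality for averages of dilated translates: if `‖f x‖` is bounded by the average of
`‖F (x - s y)‖` over a probability measure in `y`, then `‖f‖_p ≤ ‖F‖_p`. -/
theorem eLpNorm_le_of_enorm_le_lintegral_comp_sub {μ : Measure ℝ} [IsProbabilityMeasure μ]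
    {f : ℝ → ℂ} {F : ℝ → ℝ} (hF : Continuous F) (s : ℝ) {p : ℝ≥0∞} (hp : 1 ≤ p)
    (h : ∀ x, ‖f x‖ₑ ≤ ∫⁻ y, ‖F (x - s * y)‖ₑ ∂μ) :
    eLpNorm f p volume ≤ eLpNorm F p volume := by
  rcases eq_or_ne p ∞ with rfl | hp_top
  · rw [eLpNorm_exponent_top, eLpNorm_exponent_top]
    have hbound : ∀ x, ‖F x‖ₑ ≤ eLpNormEssSup F volume := by
      have hdense := Measure.dense_of_ae (ae_le_eLpNormEssSup (f := F) (μ := volume))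
      have hclosed : IsClosed {x | ‖F x‖ₑ ≤ eLpNormEssSup F volume} :=
        isClosed_le hF.enorm continuous_const
      intro x
      have : x ∈ {x | ‖F x‖ₑ ≤ eLpNormEssSup F volume} := by
        rw [← hclosed.closure_eq, hdense.closure_eq]
        trivial
      exact this
    refine eLpNormEssSup_le_of_ae_enorm_bound (.of_forall fun x => (h x).trans ?_)
    calc ∫⁻ y, ‖F (x - s * y)‖ₑ ∂μ ≤ ∫⁻ _, eLpNormEssSup F volume ∂μ :=
          lintegral_mono fun y => hbound _
      _ = eLpNormEssSup F volume := by simp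
  · have hp0 : p ≠ 0 := (zero_lt_one.trans_le hp).ne'
    have hpos : 0 < p.toReal := ENNReal.toReal_pos hp0 hp_top
    rw [eLpNorm_eq_lintegral_rpow_enorm_toReal hp0 hp_top,
      eLpNorm_eq_lintegral_rpow_enorm_toReal hp0 hp_top]
    refine ENNReal.rpow_le_rpow ?_ (by positivity)
    have hpow : ∀ x, ‖f x‖ₑ ^ p.toReal ≤ ∫⁻ y, ‖F (x - s * y)‖ₑ ^ p.toReal ∂μ := by
      intro x
      have hcont : Continuous fun y => F (x - s * y) := by fun_prop
      have := eLpNorm_le_eLpNorm_of_exponent_le (μ := μ) hp hcont.aestronglyMeasurable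
      rw [eLpNorm_one_eq_lintegral_enorm,
        eLpNorm_eq_lintegral_rpow_enorm_toReal hp0 hp_top] at this
      calc ‖f x‖ₑ ^ p.toReal
          ≤ ((∫⁻ y, ‖F (x - s * y)‖ₑ ^ p.toReal ∂μ) ^ (1 / p.toReal)) ^ p.toReal :=
            ENNReal.rpow_le_rpow ((h x).trans this) hpos.le
        _ = ∫⁻ y, ‖F (x - s * y)‖ₑ ^ p.toReal ∂μ := by
            rw [← ENNReal.rpow_mul, one_div_mul_cancel hpos.ne', ENNReal.rpow_one]
    calc ∫⁻ x, ‖f x‖ₑ ^ p.toReal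
        ≤ ∫⁻ x, ∫⁻ y, ‖F (x - s * y)‖ₑ ^ p.toReal ∂μ := lintegral_mono hpow
      _ = ∫⁻ y, (∫⁻ x, ‖F (x - s * y)‖ₑ ^ p.toReal) ∂μ := by
          refine lintegral_lintegral_swap (Measurable.aemeasurable ?_)
          have : Continuous fun z : ℝ × ℝ => F (z.1 - s * z.2) := by fun_prop
          exact this.enorm.measurable.pow_const _
      _ = ∫⁻ y, (∫⁻ x, ‖F x‖ₑ ^ p.toReal) ∂μ := by
          congr 1 with y
          exact lintegral_sub_right_eq_self (fun x => ‖F x‖ₑ ^ p.toReal) (s * y)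
      _ = ∫⁻ x, ‖F x‖ₑ ^ p.toReal := by simp

/-- The standard Cauchy probability density on `ℝ`. -/
noncomputable def cauchyDensity (y : ℝ) : ℝ := Real.pi⁻¹ * (1 + y ^ 2)⁻¹

theorem cauchyDensity_nonneg (y : ℝ) : 0 ≤ cauchyDensity y := by
  unfold cauchyDensity; positivity

theorem measurable_cauchyDensity : Measurable cauchyDensity := by
  unfold cauchyDensity; fun_prop

/-- The probability measure with density `cauchyDensity`. -/
noncomputable def cauchyProb : Measure ℝ :=
  volume.withDensity fun y => ENNReal.ofReal (cauchyDensity y)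

instance : IsProbabilityMeasure cauchyProb := by
  constructor
  rw [cauchyProb, withDensity_apply _ MeasurableSet.univ, Measure.restrict_univ,
    ← ofReal_integral_eq_lintegral_ofReal
      (f := cauchyDensity) (integrable_inv_one_add_sq.const_mul _)
      (.of_forall cauchyDensity_nonneg)]
  simp only [cauchyDensity]
  rw [integral_const_mul, integral_univ_inv_one_add_sq, inv_mul_cancel₀ Real.pi_ne_zero,
    ENNReal.ofReal_one]

theorem lintegral_cauchyProb {g : ℝ → ℝ≥0∞} (hg : Measurable g) :
    ∫⁻ y, g y ∂cauchyProb = ∫⁻ y, ENNReal.ofReal (cauchyDensity y) * g y := by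
  rw [cauchyProb, lintegral_withDensity_eq_lintegral_mul _
    measurable_cauchyDensity.ennreal_ofReal hg]
  rfl

/-- The rational weight `g` for which `e^{-iy²/4} = g(y) ∂_y (y e^{-iy²/4})`. -/
noncomputable def chirpWeight (y : ℝ) : ℂ := (1 - I * (y : ℂ) ^ 2 / 2)⁻¹

theorem one_sub_I_mul_sq_ne_zero (y : ℝ) : (1 - I * (y : ℂ) ^ 2 / 2) ≠ 0 := by
  intro h
  have := congrArg Complex.re h
  simp [pow_two] at this

theorem norm_chirpWeight_sq (y : ℝ) : ‖chirpWeight y‖ ^ 2 = (1 + y ^ 4 / 4)⁻¹ := by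
  rw [chirpWeight, norm_inv, inv_pow, ← Complex.normSq_eq_norm_sq, Complex.normSq_apply]
  congr 1
  simp [pow_two]
  ring

theorem norm_chirpWeight_le_one (y : ℝ) : ‖chirpWeight y‖ ≤ 1 := by
  have h := norm_chirpWeight_sq y
  have : (1 + y ^ 4 / 4)⁻¹ ≤ 1 := inv_le_one_of_one_le₀ (by nlinarith [sq_nonneg (y ^ 2)])
  nlinarith [norm_nonneg (chirpWeight y)]

theorem sq_mul_norm_chirpWeight_le (y : ℝ) : y ^ 2 * ‖chirpWeight y‖ ≤ 2 := by
  have h := norm_chirpWeight_sq y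
  have : (y ^ 2 * ‖chirpWeight y‖) ^ 2 ≤ 2 ^ 2 := by
    rw [mul_pow, h, ← div_eq_mul_inv, div_le_iff₀ (by positivity)]
    nlinarith
  exact le_of_sq_le_sq this (by norm_num)

theorem sq_mul_norm_chirpWeight_sq_le (y : ℝ) :
    y ^ 2 * ‖chirpWeight y‖ ^ 2 ≤ 5 * (1 + y ^ 2)⁻¹ := by
  rw [norm_chirpWeight_sq, ← div_eq_mul_inv, ← div_eq_mul_inv,
    div_le_div_iff₀ (by positivity) (by positivity)]
  nlinarith [sq_nonneg (y ^ 2 - 2)]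

theorem abs_mul_norm_chirpWeight_sq_le (y : ℝ) :
    |y| * ‖chirpWeight y‖ ^ 2 ≤ 3 * (1 + y ^ 2)⁻¹ := by
  rw [norm_chirpWeight_sq, ← div_eq_mul_inv, ← div_eq_mul_inv,
    div_le_div_iff₀ (by positivity) (by positivity)]
  have h4 : y ^ 4 = |y| ^ 4 := by rw [← abs_pow, abs_of_nonneg (by positivity)]
  rw [h4, ← sq_abs y]
  nlinarith [sq_nonneg (|y| - 1), sq_nonneg (|y| ^ 2 - |y|), sq_nonneg (|y| ^ 2 - 2), abs_nonneg y]

theorem continuous_chirpWeight : Continuous chirpWeight := by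
  unfold chirpWeight
  exact Continuous.inv₀ (by fun_prop) one_sub_I_mul_sq_ne_zero

theorem hasDerivAt_chirpWeight (y : ℝ) :
    HasDerivAt chirpWeight (I * y * chirpWeight y ^ 2) y := by
  have h1 : HasDerivAt (fun y : ℝ => (1 - I * (y : ℂ) ^ 2 / 2)) (-(I * y)) y := by
    have := ((((hasDerivAt_id (y : ℂ)).pow 2).const_mul I).div_const 2).const_sub 1
    refine this.comp_ofReal.congr_deriv ?_
    simp only [id, Nat.cast_ofNat]
    ring
  refine (h1.inv (one_sub_I_mul_sq_ne_zero y)).congr_deriv ?_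
  rw [chirpWeight, neg_neg, div_eq_mul_inv, inv_pow]

/-- The oscillating factor `e^{-iy²/4}`. -/
noncomputable def chirp (y : ℝ) : ℂ := Complex.exp (-I * (y : ℂ) ^ 2 / 4)

theorem norm_chirp (y : ℝ) : ‖chirp y‖ = 1 := by
  rw [chirp, show -I * (y : ℂ) ^ 2 / 4 = ((-y ^ 2 / 4 : ℝ) : ℂ) * I by push_cast; ring]
  exact Complex.norm_exp_ofReal_mul_I _

theorem continuous_chirp : Continuous chirp := by
  unfold chirp; fun_prop

theorem hasDerivAt_chirp (y : ℝ) : HasDerivAt chirp (-I * y / 2 * chirp y) y := by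
  have h := ((((hasDerivAt_id (y : ℂ)).pow 2).const_mul (-I)).div_const 4).cexp
  refine h.comp_ofReal.congr_deriv ?_
  simp only [id, Nat.cast_ofNat, chirp, Pi.pow_apply]
  ring

/-- Two non-stationary phase integrations by parts against `e^{-iy²/4}`. -/
theorem enorm_integral_chirp_mul_le {v v₁ v₂ : ℝ → ℂ} (hv : ∀ y, HasDerivAt v (v₁ y) y)
    (hv₁ : ∀ y, HasDerivAt v₁ (v₂ y) y) (hc : Continuous v₂) (hi : Integrable v)
    (hi₁ : Integrable v₁) (hi₂ : Integrable v₂) :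
    ‖∫ y, chirp y * v y‖ₑ ≤
      ∫⁻ y, ‖15 * Real.pi * (‖v y‖ + ‖v₁ y‖ + ‖v₂ y‖)‖ₑ ∂cauchyProb := by
  have hvc : Continuous v := continuous_iff_continuousAt.2 fun y => (hv y).continuousAt
  have hv₁c : Continuous v₁ := continuous_iff_continuousAt.2 fun y => (hv₁ y).continuousAt
  have hg := continuous_chirpWeight
  have hφ := continuous_chirp
  set a : ℝ → ℂ := fun y => chirp y * (-I * y ^ 2 * chirpWeight y ^ 2) with ha
  set b : ℝ → ℂ := fun y =>
    chirp y * (y * (chirpWeight y ^ 2 + 2 * I * y ^ 2 * chirpWeight y ^ 3)) with hb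
  set c : ℝ → ℂ := fun y => chirp y * (y ^ 2 * chirpWeight y ^ 2) with hc_def
  have hac : Continuous a := by fun_prop
  have hbc : Continuous b := by fun_prop
  have hcc : Continuous c := by fun_prop
  have hk : ∀ y : ℝ, 0 < (1 + y ^ 2)⁻¹ := fun y => by positivity
  have hk1 : ∀ y : ℝ, (1 + y ^ 2)⁻¹ ≤ 1 := fun y =>
    inv_le_one_of_one_le₀ (by nlinarith [sq_nonneg y])
  have hae : ∀ y, ‖a y‖ ≤ 15 * (1 + y ^ 2)⁻¹ := by
    intro y
    have := sq_mul_norm_chirpWeight_sq_le y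
    simp only [ha, norm_mul, norm_chirp, norm_neg, Complex.norm_I, norm_pow, Complex.norm_real,
      Real.norm_eq_abs, sq_abs, one_mul]
    linarith [hk y]
  have hce : ∀ y, ‖c y‖ ≤ 15 * (1 + y ^ 2)⁻¹ := by
    intro y
    have := sq_mul_norm_chirpWeight_sq_le y
    simp only [hc_def, norm_mul, norm_chirp, norm_pow, Complex.norm_real,
      Real.norm_eq_abs, sq_abs, one_mul]
    linarith [hk y]
  have hbe : ∀ y, ‖b y‖ ≤ 15 * (1 + y ^ 2)⁻¹ := by
    intro y
    have h1 := abs_mul_norm_chirpWeight_sq_le y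
    have h2 := sq_mul_norm_chirpWeight_le y
    have h3 : ‖chirpWeight y ^ 2 + 2 * I * y ^ 2 * chirpWeight y ^ 3‖ ≤
        5 * ‖chirpWeight y‖ ^ 2 := by
      refine (norm_add_le _ _).trans ?_
      simp only [norm_mul, Complex.norm_I, norm_pow, Complex.norm_real,
        Real.norm_eq_abs, sq_abs, mul_one, Complex.norm_ofNat]
      nlinarith [mul_le_mul_of_nonneg_right h2 (sq_nonneg ‖chirpWeight y‖)]
    simp only [hb, norm_mul, norm_chirp, Complex.norm_real, Real.norm_eq_abs, one_mul]
    nlinarith [mul_le_mul_of_nonneg_left h3 (abs_nonneg y)]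
  have hbdd : ∀ {w : ℝ → ℂ} {u : ℝ → ℂ}, Continuous w → (∀ y, ‖w y‖ ≤ 15 * (1 + y ^ 2)⁻¹) →
      Integrable u → Integrable fun y => w y * u y := fun hw hwb hu =>
    hu.bdd_mul (c := 15) hw.aestronglyMeasurable
      (.of_forall fun y => (hwb y).trans (by linarith [hk1 y]))
  have hΨ : Integrable fun y => a y * v y + b y * v₁ y + c y * v₂ y :=
    ((hbdd hac hae hi).add (hbdd hbc hbe hi₁)).add (hbdd hcc hce hi₂)
  have hφv : Integrable fun y => chirp y * v y :=
    hi.bdd_mul (c := 1) hφ.aestronglyMeasurable (.of_forall fun y => (norm_chirp y).le)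
  have hΦi : Integrable fun y => chirp y * (y * chirpWeight y) * v y - c y * v₁ y := by
    refine Integrable.sub (hi.bdd_mul (c := 2) (by fun_prop) (.of_forall fun y => ?_))
      (hbdd hcc hce hi₁)
    have h1 := norm_chirpWeight_le_one y
    have h2 := sq_mul_norm_chirpWeight_le y
    simp only [norm_mul, norm_chirp, Complex.norm_real, Real.norm_eq_abs, one_mul]
    have h3 : |y| ≤ (1 + y ^ 2) / 2 := by nlinarith [sq_nonneg (|y| - 1), sq_abs y]
    nlinarith [mul_le_mul_of_nonneg_right h3 (norm_nonneg (chirpWeight y))]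
  have hΦ : ∀ y, HasDerivAt (fun y : ℝ => chirp y * (y * chirpWeight y) * v y - c y * v₁ y)
      (chirp y * v y - (a y * v y + b y * v₁ y + c y * v₂ y)) y := by
    intro y
    have hy : HasDerivAt (fun y : ℝ => (y : ℂ)) 1 y := (hasDerivAt_id (y : ℂ)).comp_ofReal
    have h1 := ((hasDerivAt_chirp y).mul (hy.mul (hasDerivAt_chirpWeight y))).mul (hv y)
    have h2 := ((hasDerivAt_chirp y).mul
      ((hy.pow 2).mul ((hasDerivAt_chirpWeight y).pow 2))).mul (hv₁ y)
    have hg1 : (1 - I * (y : ℂ) ^ 2 / 2) * chirpWeight y = 1 :=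
      mul_inv_cancel₀ (one_sub_I_mul_sq_ne_zero y)
    refine (h1.sub h2).congr_deriv ?_
    simp only [ha, hb, Pi.mul_apply, Pi.pow_apply, hc_def, Nat.cast_ofNat]
    linear_combination (chirp y * v y - y * chirpWeight y * chirp y * v₁ y) * hg1
  have key : ∫ y, chirp y * v y = ∫ y, (a y * v y + b y * v₁ y + c y * v₂ y) := by
    have := integral_eq_zero_of_hasDerivAt_of_integrable hΦ (hφv.sub hΨ) hΦi
    rw [integral_sub hφv hΨ] at this
    exact sub_eq_zero.1 this
  rw [key, lintegral_cauchyProb (by fun_prop)]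
  refine (enorm_integral_le_lintegral_enorm _).trans (lintegral_mono fun y => ?_)
  rw [← ofReal_norm, ← ofReal_norm, ← ENNReal.ofReal_mul (cauchyDensity_nonneg y)]
  refine ENNReal.ofReal_le_ofReal ?_
  rw [Real.norm_of_nonneg (by positivity)]
  calc ‖a y * v y + b y * v₁ y + c y * v₂ y‖
      ≤ ‖a y‖ * ‖v y‖ + ‖b y‖ * ‖v₁ y‖ + ‖c y‖ * ‖v₂ y‖ := by
        simpa only [norm_mul] using norm_add₃_le (a := a y * v y) (b := b y * v₁ y) (c := c y * v₂ y)
    _ ≤ 15 * (1 + y ^ 2)⁻¹ * ‖v y‖ + 15 * (1 + y ^ 2)⁻¹ * ‖v₁ y‖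
          + 15 * (1 + y ^ 2)⁻¹ * ‖v₂ y‖ := by
        gcongr
        exacts [hae y, hbe y, hce y]
    _ = cauchyDensity y * (15 * Real.pi * (‖v y‖ + ‖v₁ y‖ + ‖v₂ y‖)) := by
        rw [cauchyDensity]
        field_simp

theorem enorm_sch_le {t : ℝ} (ht : 0 < t) (f : ℝ → ℂ) (x : ℝ) :
    ‖sch t f x‖ₑ ≤ ‖∫ y, chirp y * f (x - √t * y)‖ₑ := by
  have hs : 0 < √t := Real.sqrt_pos.2 ht
  have hst : √t ^ 2 = t := Real.sq_sqrt ht.le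
  have hint : ∫ y : ℝ, Complex.exp (-Complex.I * ((x - y : ℝ) : ℂ) ^ 2 / (4 * (t : ℂ))) * f y =
      √t • ∫ y, chirp y * f (x - √t * y) := by
    have h1 := Measure.integral_comp_mul_left
      (fun z : ℝ => Complex.exp (-Complex.I * (z : ℂ) ^ 2 / (4 * (t : ℂ))) * f (x - z)) √t
    have h2 := integral_sub_left_eq_self
      (fun z : ℝ => Complex.exp (-Complex.I * (z : ℂ) ^ 2 / (4 * (t : ℂ))) * f (x - z)) volume x
    simp only [sub_sub_cancel] at h2
    rw [h2]
    have h3 : ∀ y : ℝ, chirp y =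
        Complex.exp (-Complex.I * ((√t * y : ℝ) : ℂ) ^ 2 / (4 * (t : ℂ))) := by
      intro y
      have ht' : (t : ℂ) ≠ 0 := by exact_mod_cast ht.ne'
      have hst' : ((√t : ℝ) : ℂ) ^ 2 = t := by exact_mod_cast hst
      rw [chirp]
      congr 1
      push_cast
      rw [mul_pow, hst']
      field_simp
    simp_rw [h3]
    rw [h1, abs_of_pos (by positivity), smul_smul, mul_inv_cancel₀ hs.ne', one_smul]
  rw [sch, hint, ← ofReal_norm, ← ofReal_norm]
  refine ENNReal.ofReal_le_ofReal ?_
  have hr : 0 < 4 * Real.pi * t := by positivity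
  have hne : ((4 * Real.pi * t : ℝ) : ℂ) * I ≠ 0 :=
    mul_ne_zero (by exact_mod_cast hr.ne') Complex.I_ne_zero
  rw [norm_mul, norm_cpow_of_ne_zero hne, norm_smul, norm_mul, Complex.norm_I,
    Complex.norm_real, Real.norm_of_nonneg hr.le, Real.norm_of_nonneg hs.le]
  have hre : (-(1 / 2 : ℂ)).re = -(1 / 2 : ℝ) := by norm_num
  have him : (-(1 / 2 : ℂ)).im = 0 := by norm_num
  rw [hre, him, mul_zero, Real.exp_zero, div_one, mul_one, ← mul_assoc, Real.rpow_neg hr.le,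
    ← Real.sqrt_eq_rpow]
  refine mul_le_of_le_one_left (norm_nonneg _) ?_
  rw [inv_mul_le_iff₀ (Real.sqrt_pos.2 hr), mul_one]
  exact Real.sqrt_le_sqrt (by nlinarith [Real.pi_gt_three])

/-- Scale-invariant form of the bound, with the sharper growth in `t`. -/
theorem eLpNorm_sch_le {p : ℝ≥0∞} (hp : 1 ≤ p) {t : ℝ} (ht : 0 < t) (u : SchwartzMap ℝ ℂ) :
    eLpNorm (sch t u) p volume ≤ ENNReal.ofReal (15 * Real.pi) *
      (eLpNorm u p volume + ENNReal.ofReal √t * eLpNorm (deriv u) p volume +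
        ENNReal.ofReal t * eLpNorm (deriv (deriv u)) p volume) := by
  set u₁ := SchwartzMap.derivCLM ℝ ℂ u with hu₁
  set u₂ := SchwartzMap.derivCLM ℝ ℂ u₁ with hu₂
  have hd₁ : deriv (u : ℝ → ℂ) = u₁ := funext fun x => (SchwartzMap.derivCLM_apply ℝ u x).symm
  have hd₂ : deriv (u₁ : ℝ → ℂ) = u₂ := funext fun x => (SchwartzMap.derivCLM_apply ℝ u₁ x).symm
  have hs : 0 < √t := Real.sqrt_pos.2 ht
  have hst : √t ^ 2 = t := Real.sq_sqrt ht.le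
  have hD : ∀ (w w' : SchwartzMap ℝ ℂ), deriv (w : ℝ → ℂ) = w' → ∀ x y : ℝ,
      HasDerivAt (fun y => w (x - √t * y)) (-(√t : ℂ) * w' (x - √t * y)) y := by
    intro w w' hw x y
    have h1 : HasDerivAt w (w' (x - √t * y)) (x - √t * y) := by
      rw [← hw]; exact (w.differentiable _).hasDerivAt
    have h2 : HasDerivAt (fun y : ℝ => x - √t * y) (-√t) y := by
      simpa using ((hasDerivAt_id y).const_mul √t).const_sub x
    refine (h1.scomp y h2).congr_deriv ?_
    rw [Complex.real_smul, Complex.ofReal_neg]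
  have hI : ∀ (w : SchwartzMap ℝ ℂ) (x : ℝ), Integrable fun y => w (x - √t * y) := fun w x =>
    (w.integrable.comp_sub_left x).comp_mul_left' hs.ne'
  have hsnorm : ‖(√t : ℂ)‖ = √t := by rw [Complex.norm_real, Real.norm_of_nonneg hs.le]
  set F : ℝ → ℝ := fun x => 15 * Real.pi * (‖u x‖ + √t * ‖u₁ x‖ + t * ‖u₂ x‖) with hF
  have hcu := u.continuous
  have hcu₁ := u₁.continuous
  have hcu₂ := u₂.continuous
  have hpt : ∀ x, ‖sch t u x‖ₑ ≤ ∫⁻ y, ‖F (x - √t * y)‖ₑ ∂cauchyProb := by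
    intro x
    refine (enorm_sch_le ht u x).trans ((enorm_integral_chirp_mul_le (hD u u₁ hd₁ x)
      (fun y => (hD u₁ u₂ hd₂ x y).const_mul (-(√t : ℂ))) (by fun_prop) (hI u x)
      ((hI u₁ x).const_mul _) (((hI u₂ x).const_mul _).const_mul _)).trans_eq ?_)
    congr 1 with y
    simp only [hF, norm_mul, norm_neg, hsnorm]
    rw [← mul_assoc √t √t, Real.mul_self_sqrt ht.le]
  refine (eLpNorm_le_of_enorm_le_lintegral_comp_sub (by fun_prop) √t hp hpt).trans ?_
  rw [hd₁, hd₂]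
  have hFeq : F = (15 * Real.pi) •
      ((fun x => ‖u x‖) + √t • (fun x => ‖u₁ x‖) + t • (fun x => ‖u₂ x‖)) := by
    ext x; simp [hF]
  have hs15 : ‖15 * Real.pi‖ₑ = ENNReal.ofReal (15 * Real.pi) :=
    Real.enorm_of_nonneg (by positivity)
  rw [hFeq, eLpNorm_const_smul, hs15]
  gcongr
  refine (eLpNorm_add_le (by fun_prop) (by fun_prop) hp).trans ?_
  refine (add_le_add_left (eLpNorm_add_le (by fun_prop) (by fun_prop) hp) _).trans ?_
  rw [eLpNorm_const_smul, eLpNorm_const_smul, eLpNorm_norm, eLpNorm_norm, eLpNorm_norm,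
    Real.enorm_of_nonneg hs.le, Real.enorm_of_nonneg ht.le]

/-- dispersive-type bound for the free flow, uniform in t, p, u₀. -/
theorem stmt0 :
    ∃ C : ℝ, 0 < C ∧ ∀ (p : ℝ≥0∞), 2 ≤ p → ∀ t : ℝ, 0 < t → ∀ u₀ : SchwartzMap ℝ ℂ,
      eLpNorm (sch t u₀) p volume ≤
        ENNReal.ofReal (C * (1 + t ^ ((3 : ℝ) / 2))) *
          (eLpNorm (deriv (deriv (⇑u₀))) p volume + eLpNorm (deriv (⇑u₀)) p volume +
            eLpNorm (⇑u₀) p volume) := by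
  refine ⟨15 * Real.pi, by positivity, fun p hp t ht u₀ => ?_⟩
  refine (eLpNorm_sch_le (one_le_two.trans hp) ht u₀).trans ?_
  have hpow : ∀ r : ℝ, 0 ≤ r → r ≤ 3 / 2 → t ^ r ≤ 1 + t ^ ((3 : ℝ) / 2) := by
    intro r hr0 hr
    have hpos := Real.rpow_nonneg ht.le ((3 : ℝ) / 2)
    rcases le_total t 1 with h | h
    · linarith [Real.rpow_le_one ht.le h hr0]
    · linarith [Real.rpow_le_rpow_of_exponent_le h hr]
  set M := 1 + t ^ ((3 : ℝ) / 2)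
  have h0 : (1 : ℝ) ≤ M := by simpa using hpow 0 le_rfl (by norm_num)
  have h1 : √t ≤ M := by rw [Real.sqrt_eq_rpow]; exact hpow _ (by norm_num) (by norm_num)
  have h2 : t ≤ M := by simpa using hpow 1 zero_le_one (by norm_num)
  rw [ENNReal.ofReal_mul (p := 15 * Real.pi) (q := M) (by positivity), mul_assoc]
  refine mul_le_mul' le_rfl ?_
  calc eLpNorm u₀ p volume + ENNReal.ofReal √t * eLpNorm (deriv u₀) p volume +
        ENNReal.ofReal t * eLpNorm (deriv (deriv u₀)) p volume
      ≤ ENNReal.ofReal M * eLpNorm u₀ p volume + ENNReal.ofReal M * eLpNorm (deriv u₀) p volume +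
        ENNReal.ofReal M * eLpNorm (deriv (deriv u₀)) p volume := by
        gcongr
        exact le_mul_of_one_le_left' (ENNReal.one_le_ofReal.2 h0)
    _ = _ := by ring
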